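/- arXiv:2306.12374 — 4 statements merged into one kernel-verified Lean document; each statement's English description precedes it below -/
import Mathlib

section
/- Let E be a finite set and β > 1. For each pair i ≠ j in E let q_{ij} ≥ 0 with q_i := Σ_{j≠i} q_{ij} > 0, and let F_{ij} be a Borel probability measure on ℝ with ∫_ℝ |y| dF_{ij}(y) < ∞. Suppose f : [0,∞) × E → ℝ is such that, for every j ∈ E, the function f(·,j) is continuous with x ↦ f(x,j)/(1+x) bounded, is continuously differentiable on [0,∞), concave and nondecreasing, and satisfies f'(x,j) ≤ β for all x ≥ 0 and lim_{x→∞} f'(x,j) ≤ 1. Then for every i ∈ E the function x ↦ f̂(x,i) is concave on [0,∞), its right derivative at 0 is at most β, and the limit as x → ∞ of its right derivative exists and lies in the interval [0,1]. -/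
open MeasureTheory Filter Set

/-- The transform `f̂(x,i) := Σ_{j≠i} (q_{ij}/q_i) ∫ [ (β(x+y)+f(0,j)) 1_{x+y≤0}
+ f(x+y,j) 1_{x+y>0} ] dF_{ij}(y)`. -/
noncomputable def fhat {E : Type*} [Fintype E] [DecidableEq E]
    (β : ℝ) (q : E → E → ℝ) (qi : E → ℝ) (F : E → E → Measure ℝ)
    (f : ℝ → E → ℝ) (x : ℝ) (i : E) : ℝ :=
  ∑ j ∈ Finset.univ.erase i, (q i j / qi i) *
    ∫ y, (if x + y ≤ 0 then β * (x + y) + f 0 j else f (x + y) j) ∂(F i j)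

/-- `G` is a selection of supergradients of `g` on `ℝ` with values in `[0, β]` and limit `L`
at `+∞`. -/
structure IsBoundedSupergradient (β L : ℝ) (g G : ℝ → ℝ) : Prop where
  le_tangent : ∀ z w, g w ≤ g z + G z * (w - z)
  nonneg : ∀ z, 0 ≤ G z
  le_bound : ∀ z, G z ≤ β
  tendsto : Tendsto G atTop (nhds L)

theorem ConcaveOn.le_tangent_of_hasDerivWithinAt {S : Set ℝ} {u : ℝ → ℝ} {d z w : ℝ}
    (hu : ConcaveOn ℝ S u) (hz : z ∈ S) (hw : w ∈ S) (hd : HasDerivWithinAt u d S z) :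
    u w ≤ u z + d * (w - z) := by
  rcases lt_trichotomy z w with h | rfl | h
  · have := hu.slope_le_of_hasDerivWithinAt hz hw h hd
    rw [slope_def_field, div_le_iff₀ (sub_pos.2 h)] at this
    linarith
  · simp
  · have := hu.le_slope_of_hasDerivWithinAt hw hz h hd
    rw [slope_def_field, le_div_iff₀ (sub_pos.2 h)] at this
    linarith

/-- Extending a concave function on `[0, ∞)` linearly with slope `β` to the left of `0`. -/
theorem isBoundedSupergradient_extension {β L : ℝ} {u u' : ℝ → ℝ} (hβ : 0 ≤ β)
    (hderiv : ∀ x, 0 ≤ x → HasDerivWithinAt u (u' x) (Ici 0) x)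
    (hconc : ConcaveOn ℝ (Ici 0) u) (hmono : MonotoneOn u (Ici 0))
    (hle : ∀ x, 0 ≤ x → u' x ≤ β) (hlim : Tendsto u' atTop (nhds L)) :
    IsBoundedSupergradient β L (fun z => if z ≤ 0 then β * z + u 0 else u z)
      (fun z => if z ≤ 0 then β else u' z) := by
  have tangent : ∀ z w, 0 ≤ z → 0 ≤ w → u w ≤ u z + u' z * (w - z) := fun z w hz hw =>
    hconc.le_tangent_of_hasDerivWithinAt hz hw (hderiv z hz)
  have hnonneg : ∀ z, 0 ≤ z → 0 ≤ u' z := fun z hz => by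
    have h₁ := tangent z (z + 1) hz (by linarith)
    have h₂ : u z ≤ u (z + 1) := hmono (mem_Ici.2 hz) (mem_Ici.2 (by linarith)) (by linarith)
    linarith
  refine ⟨fun z w => ?_, fun z => ?_, fun z => ?_, ?_⟩
  · split_ifs with hw hz hz
    · linarith
    · push Not at hz
      have h₁ := tangent z 0 hz.le le_rfl
      have h₂ := mul_le_mul_of_nonpos_right (hle z hz.le) hw
      linarith
    · push Not at hw
      have h₁ := tangent 0 w le_rfl hw.le
      have h₂ := mul_le_mul_of_nonneg_right (hle 0 le_rfl) hw.le
      linarith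
    · exact tangent z w (not_le.1 hz).le (not_le.1 hw).le
  · split_ifs with hz
    exacts [hβ, hnonneg z (not_le.1 hz).le]
  · split_ifs with hz
    exacts [le_rfl, hle z (not_le.1 hz).le]
  · refine hlim.congr' ?_
    filter_upwards [eventually_gt_atTop 0] with z hz
    rw [if_neg (not_le.2 hz)]

namespace IsBoundedSupergradient

variable {β L : ℝ} {g G : ℝ → ℝ}

theorem bound_nonneg (h : IsBoundedSupergradient β L g G) : 0 ≤ β :=
  (h.nonneg 0).trans (h.le_bound 0)

theorem le_add_mul_abs (h : IsBoundedSupergradient β L g G) (w z : ℝ) :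
    g w ≤ g z + β * |w - z| :=
  (h.le_tangent z w).trans <| add_le_add_right
    ((mul_le_mul_of_nonneg_left (le_abs_self _) (h.nonneg z)).trans
      (mul_le_mul_of_nonneg_right (h.le_bound z) (abs_nonneg _))) _

theorem continuous (h : IsBoundedSupergradient β L g G) : Continuous g :=
  (LipschitzWith.of_le_add_mul (K := β.toNNReal) fun w z => by
    rw [Real.coe_toNNReal _ h.bound_nonneg, Real.dist_eq]
    exact h.le_add_mul_abs w z).continuous

theorem antitone (h : IsBoundedSupergradient β L g G) : Antitone G := by
  intro z w hzw
  rcases hzw.eq_or_lt with rfl | hlt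
  · rfl
  · have h₁ := h.le_tangent z w
    have h₂ := h.le_tangent w z
    by_contra! hG
    nlinarith [mul_pos (sub_pos.2 hlt) (sub_pos.2 hG)]

theorem concaveOn (h : IsBoundedSupergradient β L g G) : ConcaveOn ℝ univ g := by
  refine ⟨convex_univ, fun x _ y _ a b ha hb hab => ?_⟩
  simp only [smul_eq_mul]
  set m := a * x + b * y with hm
  have h₁ := mul_le_mul_of_nonneg_left (h.le_tangent m x) ha
  have h₂ := mul_le_mul_of_nonneg_left (h.le_tangent m y) hb
  calc a * g x + b * g y ≤ (a + b) * g m + G m * (a * x + b * y - (a + b) * m) := by linarith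
    _ = g m := by rw [hab, ← hm]; ring

theorem hasDerivWithinAt_rightDeriv (h : IsBoundedSupergradient β L g G) (x : ℝ) :
    HasDerivWithinAt g (derivWithin g (Ioi x) x) (Ioi x) x := by
  have := h.concaveOn.neg.differentiableWithinAt_Ioi_of_mem_interior (x := x) (by simp)
  simpa using this.neg.hasDerivWithinAt

theorem rightDeriv_le (h : IsBoundedSupergradient β L g G) (x : ℝ) :
    derivWithin g (Ioi x) x ≤ G x := by
  refine le_of_tendsto ((hasDerivWithinAt_iff_tendsto_slope' self_notMem_Ioi).1
    (h.hasDerivWithinAt_rightDeriv x)) ?_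
  filter_upwards [self_mem_nhdsWithin] with y hy
  rw [slope_def_field, div_le_iff₀ (sub_pos.2 hy)]
  linarith [h.le_tangent x y]

theorem le_rightDeriv (h : IsBoundedSupergradient β L g G) {x y : ℝ} (hxy : x < y) :
    G y ≤ derivWithin g (Ioi x) x := by
  refine le_trans ?_ (h.concaveOn.slope_le_of_hasDerivWithinAt_Ioi (mem_univ x) (mem_univ y) hxy
    (h.hasDerivWithinAt_rightDeriv x))
  rw [slope_def_field, le_div_iff₀ (sub_pos.2 hxy)]
  linarith [h.le_tangent y x]

theorem tendsto_rightDeriv (h : IsBoundedSupergradient β L g G) :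
    Tendsto (fun x => derivWithin g (Ioi x) x) atTop (nhds L) :=
  tendsto_of_tendsto_of_tendsto_of_le_of_le
    (h.tendsto.comp (tendsto_atTop_add_const_right _ 1 tendsto_id)) h.tendsto
    (fun x => h.le_rightDeriv (lt_add_one x)) h.rightDeriv_le

theorem limit_nonneg (h : IsBoundedSupergradient β L g G) : 0 ≤ L :=
  ge_of_tendsto' h.tendsto h.nonneg

theorem integral {μ : Measure ℝ} [IsProbabilityMeasure μ] (h : IsBoundedSupergradient β L g G)
    (hμ : Integrable (fun y => |y|) μ) :
    IsBoundedSupergradient β L (fun x => ∫ y, g (x + y) ∂μ) (fun x => ∫ y, G (x + y) ∂μ) := by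
  have hg : ∀ x, Integrable (fun y => g (x + y)) μ := fun x => by
    refine ((integrable_const |g x|).add (hμ.const_mul β)).mono'
      (h.continuous.comp (continuous_const_add x)).aestronglyMeasurable (ae_of_all _ fun y => ?_)
    have h₁ := h.le_add_mul_abs (x + y) x
    have h₂ := h.le_add_mul_abs x (x + y)
    rw [abs_sub_comm] at h₂
    rw [add_sub_cancel_left] at h₁ h₂
    simp only [Pi.add_apply, Real.norm_eq_abs]
    rw [abs_le]
    constructor <;> linarith [le_abs_self (g x), neg_abs_le (g x)]
  have hGm : ∀ x, AEStronglyMeasurable (fun y => G (x + y)) μ := fun x =>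
    (h.antitone.measurable.comp (measurable_const_add x)).aestronglyMeasurable
  have hGb : ∀ z, ‖G z‖ ≤ β := fun z => by
    rw [Real.norm_of_nonneg (h.nonneg z)]
    exact h.le_bound z
  have hG : ∀ x, Integrable (fun y => G (x + y)) μ := fun x =>
    (integrable_const β).mono' (hGm x) (ae_of_all _ fun y => hGb _)
  refine ⟨fun z w => ?_, fun z => integral_nonneg fun y => h.nonneg _, fun z => ?_, ?_⟩
  · rw [← integral_mul_const, ← integral_add (hg z) ((hG z).mul_const _)]
    refine integral_mono (hg w) ((hg z).add ((hG z).mul_const _)) fun y => ?_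
    have := h.le_tangent (z + y) (w + y)
    rwa [add_sub_add_right_eq_sub] at this
  · simpa using integral_mono (hG z) (integrable_const β) fun y => h.le_bound (z + y)
  · have := tendsto_integral_filter_of_dominated_convergence (μ := μ) (l := atTop)
      (F := fun x y => G (x + y)) (f := fun _ => L) (fun _ => β)
      (Eventually.of_forall hGm) (Eventually.of_forall fun x => ae_of_all _ fun y => hGb _)
      (integrable_const β)
      (ae_of_all _ fun y => h.tendsto.comp (tendsto_atTop_add_const_right _ y tendsto_id))
    simpa using this

theorem sum {ι : Type*} {s : Finset ι} {p l : ι → ℝ} {g G : ι → ℝ → ℝ}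
    (hp : ∀ j ∈ s, 0 ≤ p j) (hsum : ∑ j ∈ s, p j = 1)
    (h : ∀ j ∈ s, IsBoundedSupergradient β (l j) (g j) (G j)) :
    IsBoundedSupergradient β (∑ j ∈ s, p j * l j) (fun x => ∑ j ∈ s, p j * g j x)
      (fun x => ∑ j ∈ s, p j * G j x) := by
  refine ⟨fun z w => ?_, fun z => Finset.sum_nonneg fun j hj =>
    mul_nonneg (hp j hj) ((h j hj).nonneg z), fun z => ?_,
    tendsto_finsetSum s fun j hj => (h j hj).tendsto.const_mul _⟩
  · rw [Finset.sum_mul, ← Finset.sum_add_distrib]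
    refine Finset.sum_le_sum fun j hj => ?_
    linarith [mul_le_mul_of_nonneg_left ((h j hj).le_tangent z w) (hp j hj)]
  · calc ∑ j ∈ s, p j * G j z ≤ ∑ j ∈ s, p j * β := Finset.sum_le_sum fun j hj =>
          mul_le_mul_of_nonneg_left ((h j hj).le_bound z) (hp j hj)
      _ = β := by rw [← Finset.sum_mul, hsum, one_mul]

end IsBoundedSupergradient

theorem stmt_0 {E : Type*} [Fintype E] [DecidableEq E] [Nonempty E]
    (β : ℝ) (hβ : 1 < β)
    (q : E → E → ℝ) (hq : ∀ i j : E, i ≠ j → 0 ≤ q i j)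
    (qi : E → ℝ) (hqi : ∀ i : E, qi i = ∑ j ∈ Finset.univ.erase i, q i j)
    (hqipos : ∀ i : E, 0 < qi i)
    (F : E → E → Measure ℝ) [∀ i j : E, IsProbabilityMeasure (F i j)]
    (hF : ∀ i j : E, i ≠ j → Integrable (fun y => |y|) (F i j))
    (f f' : ℝ → E → ℝ)
    (hcont : ∀ j : E, ContinuousOn (fun x => f x j) (Ici 0))
    (hbdd : ∀ j : E, ∃ M : ℝ, ∀ x : ℝ, 0 ≤ x → |f x j| / (1 + x) ≤ M)
    (hderiv : ∀ j : E, ∀ x : ℝ, 0 ≤ x →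
      HasDerivWithinAt (fun x' => f x' j) (f' x j) (Ici 0) x)
    (hderivcont : ∀ j : E, ContinuousOn (fun x => f' x j) (Ici 0))
    (hconc : ∀ j : E, ConcaveOn ℝ (Ici 0) (fun x => f x j))
    (hmono : ∀ j : E, MonotoneOn (fun x => f x j) (Ici 0))
    (hfβ : ∀ j : E, ∀ x : ℝ, 0 ≤ x → f' x j ≤ β)
    (hflim : ∀ j : E, ∃ L : ℝ,
      Tendsto (fun x => f' x j) atTop (nhds L) ∧ L ≤ 1) :
    ∀ i : E,
      ConcaveOn ℝ (Ici 0) (fun x => fhat β q qi F f x i) ∧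
      (∃ d : ℝ, HasDerivWithinAt (fun x => fhat β q qi F f x i) d (Ioi 0) 0 ∧ d ≤ β) ∧
      (∃ L ∈ Icc (0:ℝ) 1,
        Tendsto (fun x => derivWithin (fun x' => fhat β q qi F f x' i) (Ioi x) x)
          atTop (nhds L)) := by
  intro i
  choose l hl hl1 using hflim
  have hp : ∀ j ∈ Finset.univ.erase i, 0 ≤ q i j / qi i := fun j hj =>
    div_nonneg (hq i j (Finset.ne_of_mem_erase hj).symm) (hqipos i).le
  have hsum : ∑ j ∈ Finset.univ.erase i, q i j / qi i = 1 := by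
    rw [← Finset.sum_div, ← hqi i, div_self (hqipos i).ne']
  have h := IsBoundedSupergradient.sum hp hsum fun j hj =>
    (isBoundedSupergradient_extension (zero_le_one.trans hβ.le) (hderiv j) (hconc j) (hmono j)
      (hfβ j) (hl j)).integral (hF i j (Finset.ne_of_mem_erase hj).symm)
  change IsBoundedSupergradient β _ (fun x => fhat β q qi F f x i) _ at h
  refine ⟨h.concaveOn.subset (subset_univ _) (convex_Ici 0),
    ⟨_, h.hasDerivWithinAt_rightDeriv 0, (h.rightDeriv_le 0).trans (h.le_bound 0)⟩,
    _, ⟨h.limit_nonneg, ?_⟩, h.tendsto_rightDeriv⟩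
  calc ∑ j ∈ Finset.univ.erase i, q i j / qi i * l j
      ≤ ∑ j ∈ Finset.univ.erase i, q i j / qi i :=
        Finset.sum_le_sum fun j hj => mul_le_of_le_one_right (hp j hj) (hl1 j)
    _ = 1 := hsum
end

section
/- Let E be a finite set and β > 1. For each pair i ≠ j in E let q_{ij} ≥ 0 with q_i := Σ_{j≠i} q_{ij} > 0, and let F_{ij} be a Borel probability measure on ℝ with ∫_ℝ |y| dF_{ij}(y) < ∞. If f ∈ 𝓑, then for every i ∈ E the function x ↦ f̂(x,i) is continuous on [0,∞) and satisfies |f̂(x,i)| ≤ (1+|x|) · Σ_{j≠i} (q_{ij}/q_i) (1 + ∫_ℝ |y| dF_{ij}(y)) (β + ‖f‖) for all x ≥ 0; in particular f̂ ∈ 𝓑. -/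
open MeasureTheory Filter Set

/-- The norm `‖f‖ := max_{i∈E} sup_{x ≥ 0} |f(x,i)|/(1+|x|)` on the space 𝓑. -/
noncomputable def fnorm {E : Type*} [Fintype E] (f : ℝ → E → ℝ) : ℝ :=
  ⨆ i : E, ⨆ x : {x : ℝ // 0 ≤ x}, |f x.1 i| / (1 + |x.1|)

/-- Gluing a linear function on `(-∞, 0]` to a continuous function on `[0, ∞)`. -/
lemma continuous_ite_nonpos_linear {β : ℝ} {h : ℝ → ℝ} (hh : ContinuousOn h (Ici 0)) :
    Continuous fun z : ℝ => if z ≤ 0 then β * z + h 0 else h z := by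
  have key : (fun z : ℝ => if z ≤ 0 then β * z + h 0 else h z) =
      fun z => β * min z 0 + h (max z 0) := by
    funext z
    split_ifs with hz
    · rw [min_eq_left hz, max_eq_right hz]
    · rw [min_eq_right (not_le.1 hz).le, max_eq_left (not_le.1 hz).le, mul_zero, zero_add]
  rw [key]
  have : Continuous fun z : ℝ => h (max z 0) :=
    hh.comp_continuous (by fun_prop) fun z => le_max_right z 0
  exact (by fun_prop : Continuous fun z : ℝ => β * min z 0).add this

lemma abs_ite_nonpos_linear_le {β N : ℝ} {h : ℝ → ℝ} (hβ : 0 ≤ β)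
    (hN : ∀ x, 0 ≤ x → |h x| ≤ N * (1 + |x|)) (z : ℝ) :
    |if z ≤ 0 then β * z + h 0 else h z| ≤ (β + N) * (1 + |z|) := by
  have h0 : |h 0| ≤ N := by simpa using hN 0 le_rfl
  have hN0 : 0 ≤ N := (abs_nonneg _).trans h0
  have hz0 := abs_nonneg z
  split_ifs with hz
  · calc |β * z + h 0| ≤ |β * z| + |h 0| := abs_add_le _ _
      _ ≤ β * |z| + N := by rw [abs_mul, abs_of_nonneg hβ]; gcongr
      _ ≤ (β + N) * (1 + |z|) := by nlinarith [mul_nonneg hN0 hz0]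
  · calc |h z| ≤ N * (1 + |z|) := hN z (not_le.1 hz).le
      _ ≤ (β + N) * (1 + |z|) := by gcongr; linarith

lemma abs_add_le_mul_of_linear_growth {g : ℝ → ℝ} {C : ℝ} (hg : ∀ z, |g z| ≤ C * (1 + |z|))
    (x y : ℝ) : |g (x + y)| ≤ C * (1 + |x|) * (1 + |y|) := by
  have hC : 0 ≤ C := by simpa using (abs_nonneg _).trans (hg 0)
  calc |g (x + y)| ≤ C * (1 + |x + y|) := hg _
    _ ≤ C * ((1 + |x|) * (1 + |y|)) := by
      gcongr
      nlinarith [abs_add_le x y, mul_nonneg (abs_nonneg x) (abs_nonneg y)]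
    _ = C * (1 + |x|) * (1 + |y|) := by ring

/-- Translating a continuous function of linear growth under the integral sign is continuous. -/
lemma continuous_integral_translate {μ : Measure ℝ} [IsFiniteMeasure μ]
    (hμ : Integrable (fun y => |y|) μ) {g : ℝ → ℝ} (hg : Continuous g) {C : ℝ}
    (hgC : ∀ z, |g z| ≤ C * (1 + |z|)) : Continuous fun x => ∫ y, g (x + y) ∂μ := by
  have hC : 0 ≤ C := by simpa using (abs_nonneg _).trans (hgC 0)
  refine continuous_iff_continuousAt.2 fun x₀ => ?_
  refine continuousAt_of_dominated (bound := fun y => C * (1 + (|x₀| + 1)) * (1 + |y|))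
    (Eventually.of_forall fun x => ?_) ?_ (((integrable_const 1).add hμ).const_mul _)
    (Eventually.of_forall fun y => ?_)
  · exact (hg.comp (continuous_const.add continuous_id)).aestronglyMeasurable
  · have hx : ∀ᶠ x in nhds x₀, |x| < |x₀| + 1 :=
      continuous_abs.continuousAt.eventually_lt_const (lt_add_one _)
    filter_upwards [hx] with x hx
    refine Eventually.of_forall fun y => (abs_add_le_mul_of_linear_growth hgC x y).trans ?_
    gcongr
  · exact (hg.comp (continuous_id.add continuous_const)).continuousAt

lemma abs_integral_translate_le {μ : Measure ℝ} [IsProbabilityMeasure μ]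
    (hμ : Integrable (fun y => |y|) μ) {g : ℝ → ℝ} {C : ℝ}
    (hgC : ∀ z, |g z| ≤ C * (1 + |z|)) (x : ℝ) :
    |∫ y, g (x + y) ∂μ| ≤ (1 + |x|) * ((1 + ∫ y, |y| ∂μ) * C) := by
  have hint : Integrable (fun y => C * (1 + |x|) * (1 + |y|)) μ :=
    ((integrable_const 1).add hμ).const_mul _
  calc |∫ y, g (x + y) ∂μ| ≤ ∫ y, C * (1 + |x|) * (1 + |y|) ∂μ :=
        norm_integral_le_of_norm_le (f := fun y => g (x + y)) hint
          (Eventually.of_forall fun y => abs_add_le_mul_of_linear_growth hgC x y)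
    _ = (1 + |x|) * ((1 + ∫ y, |y| ∂μ) * C) := by
      rw [integral_const_mul, integral_add (integrable_const 1) hμ]
      simp
      ring

lemma abs_le_fnorm_mul {E : Type*} [Fintype E] {f : ℝ → E → ℝ}
    (hbdd : ∀ i : E, ∃ M : ℝ, ∀ x : ℝ, 0 ≤ x → |f x i| / (1 + |x|) ≤ M)
    (i : E) {x : ℝ} (hx : 0 ≤ x) : |f x i| ≤ fnorm f * (1 + |x|) := by
  obtain ⟨M, hM⟩ := hbdd i
  rw [← div_le_iff₀ (by positivity)]
  calc |f x i| / (1 + |x|) ≤ ⨆ x : {x : ℝ // 0 ≤ x}, |f x.1 i| / (1 + |x.1|) :=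
        le_ciSup (f := fun x : {x : ℝ // 0 ≤ x} => |f x.1 i| / (1 + |x.1|))
          ⟨M, by rintro _ ⟨z, rfl⟩; exact hM z.1 z.2⟩ ⟨x, hx⟩
    _ ≤ fnorm f :=
        le_ciSup (f := fun i : E => ⨆ x : {x : ℝ // 0 ≤ x}, |f x.1 i| / (1 + |x.1|))
          (Set.finite_range _).bddAbove i

theorem stmt_1 {E : Type*} [Fintype E] [DecidableEq E] [Nonempty E]
    (β : ℝ) (hβ : 1 < β)
    (q : E → E → ℝ) (hq : ∀ i j : E, i ≠ j → 0 ≤ q i j)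
    (qi : E → ℝ) (hqi : ∀ i : E, qi i = ∑ j ∈ Finset.univ.erase i, q i j)
    (hqipos : ∀ i : E, 0 < qi i)
    (F : E → E → Measure ℝ) [∀ i j : E, IsProbabilityMeasure (F i j)]
    (hF : ∀ i j : E, i ≠ j → Integrable (fun y => |y|) (F i j))
    (f : ℝ → E → ℝ)
    (hcont : ∀ i : E, ContinuousOn (fun x => f x i) (Ici 0))
    (hbdd : ∀ i : E, ∃ M : ℝ, ∀ x : ℝ, 0 ≤ x → |f x i| / (1 + |x|) ≤ M) :
    ∀ i : E,
      ContinuousOn (fun x => fhat β q qi F f x i) (Ici 0) ∧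
      (∀ x : ℝ, 0 ≤ x →
        |fhat β q qi F f x i| ≤
          (1 + |x|) * ∑ j ∈ Finset.univ.erase i,
            (q i j / qi i) * (1 + ∫ y, |y| ∂(F i j)) * (β + fnorm f)) ∧
      (∃ M : ℝ, ∀ x : ℝ, 0 ≤ x → |fhat β q qi F f x i| / (1 + |x|) ≤ M) := by
  intro i
  have hg (j : E) := continuous_ite_nonpos_linear (β := β) (hcont j)
  have hgC (j : E) := abs_ite_nonpos_linear_le (by linarith : 0 ≤ β)
    fun x hx => abs_le_fnorm_mul hbdd j hx
  have hFi {j : E} (hj : j ∈ Finset.univ.erase i) := hF i j (Finset.ne_of_mem_erase hj).symm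
  have hbound (x : ℝ) : |fhat β q qi F f x i| ≤
      (1 + |x|) * ∑ j ∈ Finset.univ.erase i,
        (q i j / qi i) * (1 + ∫ y, |y| ∂(F i j)) * (β + fnorm f) := by
    rw [Finset.mul_sum]
    refine (Finset.abs_sum_le_sum_abs _ _).trans (Finset.sum_le_sum fun j hj => ?_)
    have hw : 0 ≤ q i j / qi i :=
      div_nonneg (hq i j (Finset.ne_of_mem_erase hj).symm) (hqipos i).le
    rw [abs_mul, abs_of_nonneg hw]
    refine (mul_le_mul_of_nonneg_left
      (abs_integral_translate_le (hFi hj) (hgC j) x) hw).trans_eq ?_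
    ring
  refine ⟨?_, fun x _ => hbound x, _, fun x _ => (div_le_iff₀' (by positivity)).2 (hbound x)⟩
  exact (continuous_finsetSum _ fun j hj => continuous_const.mul
    (continuous_integral_translate (hFi hj) (hg j) (hgC j))).continuousOn
end

section
/- Let φ : [0,∞) → ℝ be Borel measurable with c ≤ φ(s) ≤ C for all s ≥ 0, for constants 0 < c ≤ C, and let μ be a σ-finite Borel measure on [0,∞). Then ∫_{[0,∞)} exp( − ∫_0^t φ(s) ds ) μ(dt) = ∫_0^∞ φ(u) · exp( − ∫_0^u φ(s) ds ) · μ([0,u]) du, as an identity in [0,∞], where the right-hand side is a Lebesgue integral in u over (0,∞). -/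
open MeasureTheory Set
open Filter
open scoped NNReal Topology

/-- Composing an absolutely continuous function with a Lipschitz function preserves absolute
continuity. -/
lemma LipschitzOnWith.comp_absolutelyContinuousOnInterval {X Y : Type*} [PseudoMetricSpace X]
    [PseudoMetricSpace Y] {g : X → Y} {K : ℝ≥0} {s : Set X} {f : ℝ → X} {a b : ℝ}
    (hg : LipschitzOnWith K g s) (hf : AbsolutelyContinuousOnInterval f a b)
    (hfs : MapsTo f (uIcc a b) s) : AbsolutelyContinuousOnInterval (fun x ↦ g (f x)) a b := by
  rw [absolutelyContinuousOnInterval_iff] at hf ⊢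
  intro ε hε
  obtain ⟨δ, hδ, h⟩ := hf (ε / (K + 1)) (by positivity)
  refine ⟨δ, hδ, fun E hE hEδ ↦ ?_⟩
  calc ∑ i ∈ Finset.range E.1, dist (g (f (E.2 i).1)) (g (f (E.2 i).2))
      ≤ ∑ i ∈ Finset.range E.1, (K + 1) * dist (f (E.2 i).1) (f (E.2 i).2) := by
        refine Finset.sum_le_sum fun i hi ↦ ?_
        have hmem := hE.1 i hi
        exact (hg.dist_le_mul _ (hfs hmem.1) _ (hfs hmem.2)).trans
          (by gcongr; exact le_add_of_nonneg_right zero_le_one)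
    _ = (K + 1) * ∑ i ∈ Finset.range E.1, dist (f (E.2 i).1) (f (E.2 i).2) :=
        (Finset.mul_sum ..).symm
    _ < (K + 1) * (ε / (K + 1)) := by gcongr; exact h E hE hEδ
    _ = ε := by field_simp

lemma lipschitzOnWith_exp_neg_Ici : LipschitzOnWith 1 (fun x : ℝ ↦ Real.exp (-x)) (Ici 0) := by
  refine (convex_Ici 0).lipschitzOnWith_of_nnnorm_hasDerivWithin_le
    (fun x _ ↦ (hasDerivAt_neg x).exp.hasDerivWithinAt) fun x hx ↦ ?_
  rw [← NNReal.coe_le_coe]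
  simpa using hx

lemma intervalIntegrable_of_locallyIntegrable {φ : ℝ → ℝ} (hloc : LocallyIntegrable φ) (a b : ℝ) :
    IntervalIntegrable φ volume a b :=
  (hloc.integrableOn_isCompact isCompact_uIcc).intervalIntegrable

/-- Fundamental theorem of calculus for `u ↦ exp (-∫_0^u φ)`, with `φ` merely locally integrable. -/
lemma integral_mul_exp_neg_integral {φ : ℝ → ℝ} (hloc : LocallyIntegrable φ)
    (hnonneg : ∀ s, 0 ≤ φ s) {a b : ℝ} (ha : 0 ≤ a) (hab : a ≤ b) :
    ∫ u in a..b, φ u * Real.exp (-∫ s in (0:ℝ)..u, φ s)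
      = Real.exp (-∫ s in (0:ℝ)..a, φ s) - Real.exp (-∫ s in (0:ℝ)..b, φ s) := by
  have hint := intervalIntegrable_of_locallyIntegrable hloc
  have hac : AbsolutelyContinuousOnInterval (fun u ↦ ∫ s in (0:ℝ)..u, φ s) a b :=
    ((hint 0 b).absolutelyContinuousOnInterval_intervalIntegral left_mem_uIcc).mono
      (uIcc_subset_uIcc (by simp [uIcc_of_le, ha, hab, ha.trans hab]) right_mem_uIcc)
  have hmaps : MapsTo (fun u ↦ ∫ s in (0:ℝ)..u, φ s) (uIcc a b) (Ici 0) := fun u hu ↦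
    intervalIntegral.integral_nonneg (ha.trans (uIcc_of_le hab ▸ hu).1) fun s _ ↦ hnonneg s
  have key := (lipschitzOnWith_exp_neg_Ici.comp_absolutelyContinuousOnInterval hac
    hmaps).integral_deriv_eq_sub
  rw [← neg_sub, ← key, ← intervalIntegral.integral_neg]
  refine intervalIntegral.integral_congr_ae ?_
  filter_upwards [LocallyIntegrable.ae_hasDerivAt_integral hloc] with u hu _
  rw [(hu 0).fun_neg.exp.deriv]
  ring

lemma lintegral_Ioi_mul_exp_neg_integral {φ : ℝ → ℝ}
    (hloc : LocallyIntegrable φ) (hnonneg : ∀ s, 0 ≤ φ s)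
    (htop : Tendsto (fun u ↦ ∫ s in (0:ℝ)..u, φ s) atTop atTop) {a : ℝ} (ha : 0 ≤ a) :
    ∫⁻ u in Ioi a, ENNReal.ofReal (φ u * Real.exp (-∫ s in (0:ℝ)..u, φ s))
      = ENNReal.ofReal (Real.exp (-∫ s in (0:ℝ)..a, φ s)) := by
  have hint := intervalIntegrable_of_locallyIntegrable hloc
  have hcont : Continuous fun u ↦ Real.exp (-∫ s in (0:ℝ)..u, φ s) :=
    (intervalIntegral.continuous_primitive hint 0).neg.rexp
  have hmeas : AEStronglyMeasurable fun u ↦ φ u * Real.exp (-∫ s in (0:ℝ)..u, φ s) :=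
    hloc.aestronglyMeasurable.mul hcont.aestronglyMeasurable
  refine (aecover_Iic tendsto_id).lintegral_eq_of_tendsto _
    hmeas.aemeasurable.ennreal_ofReal.restrict ?_
  have hlim : Tendsto (fun b ↦ ENNReal.ofReal (Real.exp (-∫ s in (0:ℝ)..a, φ s)
      - Real.exp (-∫ s in (0:ℝ)..b, φ s))) atTop
      (𝓝 (ENNReal.ofReal (Real.exp (-∫ s in (0:ℝ)..a, φ s)))) := by
    refine ENNReal.tendsto_ofReal ?_
    simpa using tendsto_const_nhds.sub
      (Real.tendsto_exp_atBot.comp (tendsto_neg_atTop_atBot.comp htop))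
  refine hlim.congr' ?_
  filter_upwards [eventually_ge_atTop a] with b hab
  rw [← integral_mul_exp_neg_integral hloc hnonneg ha hab,
    intervalIntegral.integral_of_le hab, Measure.restrict_restrict measurableSet_Iic, id,
    Iic_inter_Ioi, ofReal_integral_eq_lintegral_ofReal]
  · exact ((hint a b).mul_continuousOn hcont.continuousOn).1
  · exact ae_of_all _ fun u ↦ mul_nonneg (hnonneg u) (Real.exp_pos _).le

/-- The identity for a locally integrable nonnegative rate `φ` with divergent integral, by Tonelli's
theorem. -/
lemma lintegral_Ici_exp_neg_integral {φ : ℝ → ℝ}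
    (hloc : LocallyIntegrable φ) (hnonneg : ∀ s, 0 ≤ φ s)
    (htop : Tendsto (fun u ↦ ∫ s in (0:ℝ)..u, φ s) atTop atTop) (μ : Measure ℝ) [SFinite μ] :
    ∫⁻ t in Ici (0:ℝ), ENNReal.ofReal (Real.exp (-∫ s in (0:ℝ)..t, φ s)) ∂μ
      = ∫⁻ u in Ioi (0:ℝ),
          ENNReal.ofReal (φ u * Real.exp (-∫ s in (0:ℝ)..u, φ s)) * μ (Icc 0 u) := by
  have hcont : Continuous fun u ↦ Real.exp (-∫ s in (0:ℝ)..u, φ s) :=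
    (intervalIntegral.continuous_primitive
      (intervalIntegrable_of_locallyIntegrable hloc) 0).neg.rexp
  set h : ℝ → ENNReal := fun u ↦ ENNReal.ofReal (φ u * Real.exp (-∫ s in (0:ℝ)..u, φ s))
  have hmeas : AEMeasurable h :=
    (hloc.aestronglyMeasurable.mul hcont.aestronglyMeasurable).aemeasurable.ennreal_ofReal
  calc ∫⁻ t in Ici (0:ℝ), ENNReal.ofReal (Real.exp (-∫ s in (0:ℝ)..t, φ s)) ∂μ
      = ∫⁻ t in Ici (0:ℝ), (∫⁻ u in Ici 0, {p : ℝ × ℝ | p.1 ≤ p.2}.indicator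
          (fun p ↦ h p.2) (t, u)) ∂μ := by
        refine setLIntegral_congr_fun measurableSet_Ici fun t ht ↦ ?_
        change _ = ∫⁻ u in Ici 0, (Ici t).indicator h u
        rw [setLIntegral_indicator measurableSet_Ici,
          inter_eq_left.2 (Ici_subset_Ici.2 ht), ← restrict_Ioi_eq_restrict_Ici,
          lintegral_Ioi_mul_exp_neg_integral hloc hnonneg htop ht]
    _ = ∫⁻ u in Ici 0, ∫⁻ t in Ici (0:ℝ), {p : ℝ × ℝ | p.1 ≤ p.2}.indicator
          (fun p ↦ h p.2) (t, u) ∂μ :=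
        lintegral_lintegral_swap <| hmeas.restrict.comp_snd.indicator
          (measurableSet_le measurable_fst measurable_snd)
    _ = ∫⁻ u in Ici 0, h u * μ (Icc 0 u) := by
        refine lintegral_congr fun u ↦ ?_
        change ∫⁻ t in Ici 0, (Iic u).indicator (fun _ ↦ h u) t ∂μ = _
        rw [setLIntegral_indicator measurableSet_Iic, setLIntegral_const, inter_comm,
          Ici_inter_Iic]
    _ = _ := by rw [restrict_Ioi_eq_restrict_Ici]

/-- For a measurable discount rate `φ` with `0 < c ≤ φ ≤ C` on `[0,∞)` and a
σ-finite Borel measure `μ` on `[0,∞)`,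
`∫_{[0,∞)} exp(-∫_0^t φ) μ(dt) = ∫_0^∞ φ(u) exp(-∫_0^u φ) μ([0,u]) du`
as an identity in `[0,∞]`. -/
theorem stmt_12 (c C : ℝ) (hc : 0 < c) (hcC : c ≤ C)
    (φ : ℝ → ℝ) (hmeas : Measurable φ)
    (hφ : ∀ s : ℝ, 0 ≤ s → c ≤ φ s ∧ φ s ≤ C)
    (μ : Measure ℝ) [SigmaFinite μ] :
    ∫⁻ t in Ici (0:ℝ), ENNReal.ofReal (Real.exp (-∫ s in (0:ℝ)..t, φ s)) ∂μ
      = ∫⁻ u in Ioi (0:ℝ),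
          ENNReal.ofReal (φ u * Real.exp (-∫ s in (0:ℝ)..u, φ s)) * μ (Icc 0 u) := by
  set ψ : ℝ → ℝ := fun s ↦ φ |s|
  have hψ (s : ℝ) : c ≤ ψ s ∧ ψ s ≤ C := hφ _ (abs_nonneg s)
  have hψφ {t : ℝ} (ht : 0 ≤ t) : ∫ s in (0:ℝ)..t, ψ s = ∫ s in (0:ℝ)..t, φ s :=
    intervalIntegral.integral_congr fun s hs ↦ by
      simp only [ψ, abs_of_nonneg (uIcc_of_le ht ▸ hs).1]
  have hloc : LocallyIntegrable ψ :=
    (locallyIntegrable_const C).mono (hmeas.comp measurable_abs).aestronglyMeasurable <|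
      ae_of_all _ fun s ↦ by
        rw [Real.norm_of_nonneg (hc.le.trans (hψ s).1), Real.norm_of_nonneg (hc.le.trans hcC)]
        exact (hψ s).2
  have htop : Tendsto (fun u ↦ ∫ s in (0:ℝ)..u, ψ s) atTop atTop := by
    refine tendsto_atTop_mono' _ ?_ (tendsto_id.atTop_mul_const hc)
    filter_upwards [eventually_ge_atTop 0] with u hu
    simpa using intervalIntegral.integral_mono_on hu intervalIntegrable_const
      (intervalIntegrable_of_locallyIntegrable hloc 0 u) fun s _ ↦ (hψ s).1
  have key := lintegral_Ici_exp_neg_integral hloc (fun s ↦ hc.le.trans (hψ s).1) htop μ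
  convert! key using 1
  · exact setLIntegral_congr_fun measurableSet_Ici fun t ht ↦ by simp only [hψφ ht]
  · refine setLIntegral_congr_fun measurableSet_Ioi fun u hu ↦ ?_
    simp only [hψφ (le_of_lt hu), ψ, abs_of_pos (mem_Ioi.1 hu)]
end

section
/- Let φ : [0,∞) → ℝ be Borel measurable with c ≤ φ(s) ≤ C for all s ≥ 0, for constants 0 < c ≤ C, and let β ≥ 1. Let L, R : [0,∞) → [0,∞) be nondecreasing and right-continuous, and let X : [0,∞) → ℝ be right-continuous with X(0) ≥ 0 and with X̄(u) := sup_{s∈[0,u]} X(s) finite for every u (so that X̄ is nondecreasing, nonnegative and right-continuous). Assume that X(u) − L(u) + R(u) ≥ 0 for every u ≥ 0. Let μ_L, μ_R, μ_{X̄} denote the Lebesgue–Stieltjes measures on [0,∞) determined by μ_L([0,u]) = L(u), μ_R([0,u]) = R(u), μ_{X̄}([0,u]) = X̄(u) for u ≥ 0 (so each places an atom at 0 equal to the value of the corresponding function at 0). Then ∫_{[0,∞)} exp( − ∫_0^t φ(s) ds ) μ_L(dt) ≤ ∫_{[0,∞)} exp( − ∫_0^t φ(s) ds ) μ_{X̄}(dt)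 + β · ∫_{[0,∞)} exp( − ∫_0^t φ(s) ds ) μ_R(dt), as an inequality in [0,∞]. -/
open MeasureTheory Set

/-- If `μ [0,u] ≤ ν [0,u]` for all `u ≥ 0`, then integrals over `[0,∞)` of a continuous, nonnegative
antitone function vanishing at infinity are ordered the same way. -/
theorem setLIntegral_Ici_le_of_measure_Icc_le {μ ν : Measure ℝ} {f : ℝ → ℝ}
    (hcont : Continuous f) (hanti : Antitone f) (hnonneg : ∀ t, 0 ≤ f t)
    (hlim : Filter.Tendsto f Filter.atTop (nhds 0))
    (h : ∀ u : ℝ, 0 ≤ u → μ (Icc 0 u) ≤ ν (Icc 0 u)) :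
    ∫⁻ t in Ici (0 : ℝ), ENNReal.ofReal (f t) ∂μ
      ≤ ∫⁻ t in Ici (0 : ℝ), ENNReal.ofReal (f t) ∂ν := by
  rw [lintegral_eq_lintegral_meas_le _ (Filter.Eventually.of_forall hnonneg)
      hcont.measurable.aemeasurable,
    lintegral_eq_lintegral_meas_le _ (Filter.Eventually.of_forall hnonneg)
      hcont.measurable.aemeasurable]
  refine setLIntegral_mono' measurableSet_Ioi fun r hr => ?_
  have hclosed : IsClosed {a | r ≤ f a} := isClosed_le continuous_const hcont
  rw [Measure.restrict_apply hclosed.measurableSet, Measure.restrict_apply hclosed.measurableSet]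
  rcases ({a | r ≤ f a} ∩ Ici (0 : ℝ)).eq_empty_or_nonempty with he | hne
  · simp [he]
  have hbdd : BddAbove ({a | r ≤ f a} ∩ Ici (0 : ℝ)) := by
    obtain ⟨b, hb⟩ := (hlim.eventually_lt_const hr).exists
    refine ⟨b, fun a ha => ?_⟩
    by_contra! hlt
    exact (ha.1.trans (hanti hlt.le)).not_gt hb
  have hmem := (hclosed.inter isClosed_Ici).csSup_mem hne hbdd
  have heq : {a | r ≤ f a} ∩ Ici (0 : ℝ) = Icc 0 (sSup ({a | r ≤ f a} ∩ Ici (0 : ℝ))) :=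
    Subset.antisymm (fun a ha => ⟨ha.2, le_csSup hbdd ha⟩)
      fun a ha => ⟨hmem.1.trans (hanti ha.2), ha.1⟩
  rw [heq]
  exact h _ hmem.2

/-- Admissibility inequality: with pathwise discount rate `φ` (with
`0 < c ≤ φ ≤ C` on `[0,∞)`), cost of capital `β ≥ 1`, nondecreasing
right-continuous cumulative dividend/injection paths `L, R ≥ 0`, a
right-continuous path `X` with `X(0) ≥ 0` bounded above on compacts, running
supremum `X̄(u) = sup_{[0,u]} X`, and nonnegative controlled path
`X - L + R ≥ 0`, the Lebesgue–Stieltjes integrals (for the measures determined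
by `μ_G([0,u]) = G(u)` on `[0,∞)`) satisfy
`∫ e^{-Λ(t)} dμ_L ≤ ∫ e^{-Λ(t)} dμ_{X̄} + β ∫ e^{-Λ(t)} dμ_R` in `[0,∞]`. -/
theorem stmt_13 (c C : ℝ) (hc : 0 < c) (hcC : c ≤ C)
    (φ : ℝ → ℝ) (hφmeas : Measurable φ)
    (hφ : ∀ s : ℝ, 0 ≤ s → c ≤ φ s ∧ φ s ≤ C)
    (β : ℝ) (hβ : 1 ≤ β)
    (L R X : ℝ → ℝ)
    (hLmono : MonotoneOn L (Ici 0)) (hLnonneg : ∀ u : ℝ, 0 ≤ u → 0 ≤ L u)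
    (hLrc : ∀ u : ℝ, 0 ≤ u → ContinuousWithinAt L (Ici u) u)
    (hRmono : MonotoneOn R (Ici 0)) (hRnonneg : ∀ u : ℝ, 0 ≤ u → 0 ≤ R u)
    (hRrc : ∀ u : ℝ, 0 ≤ u → ContinuousWithinAt R (Ici u) u)
    (hXrc : ∀ u : ℝ, 0 ≤ u → ContinuousWithinAt X (Ici u) u)
    (hX0 : 0 ≤ X 0)
    (hXbdd : ∀ u : ℝ, 0 ≤ u → BddAbove (X '' Icc 0 u))
    (hU : ∀ u : ℝ, 0 ≤ u → 0 ≤ X u - L u + R u)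
    (μL μR μS : Measure ℝ)
    (hμL : ∀ u : ℝ, 0 ≤ u → μL (Icc 0 u) = ENNReal.ofReal (L u))
    (hμL0 : μL (Iio 0) = 0)
    (hμR : ∀ u : ℝ, 0 ≤ u → μR (Icc 0 u) = ENNReal.ofReal (R u))
    (hμR0 : μR (Iio 0) = 0)
    (hμS : ∀ u : ℝ, 0 ≤ u → μS (Icc 0 u) = ENNReal.ofReal (sSup (X '' Icc 0 u)))
    (hμS0 : μS (Iio 0) = 0) :
    ∫⁻ t in Ici (0:ℝ), ENNReal.ofReal (Real.exp (-∫ s in (0:ℝ)..t, φ s)) ∂μL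
      ≤ (∫⁻ t in Ici (0:ℝ), ENNReal.ofReal (Real.exp (-∫ s in (0:ℝ)..t, φ s)) ∂μS)
        + ENNReal.ofReal β *
          ∫⁻ t in Ici (0:ℝ), ENNReal.ofReal (Real.exp (-∫ s in (0:ℝ)..t, φ s)) ∂μR := by
  set ψ : ℝ → ℝ := fun s => φ (max s 0) with hψ
  have hψb : ∀ s, c ≤ ψ s ∧ ψ s ≤ C := fun s => hφ _ (le_max_right _ _)
  have hψint : ∀ a b, IntervalIntegrable ψ volume a b := fun a b =>
    (intervalIntegrable_const (c := C)).mono_fun'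
      (hφmeas.comp (measurable_id.max measurable_const)).aestronglyMeasurable
      (Filter.Eventually.of_forall fun s => by
        have := hψb s
        exact abs_le.2 ⟨by linarith, this.2⟩)
  have hcongr : ∀ μ : Measure ℝ,
      ∫⁻ t in Ici (0 : ℝ), ENNReal.ofReal (Real.exp (-∫ s in (0 : ℝ)..t, φ s)) ∂μ
        = ∫⁻ t in Ici (0 : ℝ), ENNReal.ofReal (Real.exp (-∫ s in (0 : ℝ)..t, ψ s)) ∂μ := by
    refine fun μ => setLIntegral_congr_fun measurableSet_Ici fun t ht => ?_
    have ht' : (0 : ℝ) ≤ t := ht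
    have : ∫ s in (0 : ℝ)..t, φ s = ∫ s in (0 : ℝ)..t, ψ s :=
      intervalIntegral.integral_congr fun s hs => by
        rw [uIcc_of_le ht'] at hs
        simp [hψ, max_eq_left hs.1]
    simp only [this]
  have hgrow : ∀ a b : ℝ, a ≤ b →
      (∫ s in (0 : ℝ)..a, ψ s) + c * (b - a) ≤ ∫ s in (0 : ℝ)..b, ψ s := by
    intro a b hab
    rw [← intervalIntegral.integral_add_adjacent_intervals (hψint 0 a) (hψint a b)]
    have := intervalIntegral.integral_mono_on hab intervalIntegrable_const (hψint a b)
      fun s _ => (hψb s).1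
    rw [intervalIntegral.integral_const, smul_eq_mul] at this
    linarith
  have hle : ∀ u : ℝ, 0 ≤ u → μL (Icc 0 u) ≤ (μS + μR) (Icc 0 u) := by
    intro u hu
    rw [Measure.add_apply, hμL u hu, hμS u hu, hμR u hu]
    refine (ENNReal.ofReal_le_ofReal ?_).trans ENNReal.ofReal_add_le
    have := le_csSup (hXbdd u hu) (mem_image_of_mem X (right_mem_Icc.2 hu))
    linarith [hU u hu]
  have hmain := setLIntegral_Ici_le_of_measure_Icc_le
    (f := fun t => Real.exp (-∫ s in (0 : ℝ)..t, ψ s))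
    (Real.continuous_exp.comp (intervalIntegral.continuous_primitive hψint 0).neg)
    (fun a b hab => Real.exp_le_exp.2 (neg_le_neg (by
      have := hgrow a b hab
      have := mul_nonneg hc.le (sub_nonneg.2 hab)
      linarith)))
    (fun t => (Real.exp_pos _).le)
    (Real.tendsto_exp_neg_atTop_nhds_zero.comp
      (Filter.tendsto_atTop_mono' _ ((Filter.eventually_ge_atTop 0).mono fun t ht => by
        simpa using hgrow 0 t ht) (Filter.tendsto_id.const_mul_atTop hc)))
    hle
  rw [hcongr, hcongr, hcongr]
  refine hmain.trans ?_
  rw [Measure.restrict_add, lintegral_add_measure]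
  gcongr
  exact le_mul_of_one_le_left zero_le (ENNReal.one_le_ofReal.2 hβ)
end
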